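/- Let M ≥ 2, let t₀ < t₁ < ⋯ < t_M with Δt_n := t_n − t_{n−1}, let σ_n > 0 for n = 1,…,M, let f : ℝ × ℝ → ℝ be measurable, and let a, b ∈ ℝ. Set V := Σ_{n=1}^{M} σ_n²·Δt_n, and let β be the probability measure on ℝ^{M−1} (the discrete Brownian bridge from a at time t₀ to b at time t_M) whose density with respect to Lebesgue measure at (x₁,…,x_{M−1}) is [∏_{n=1}^{M} N(x_n; x_{n−1}, σ_n²·Δt_n)] / N(b; a, V), with the conventions x₀ = a and x_M = b. Then the marginal transition density of the Euler–Maruyama chain with drift f satisfies ∫_{ℝ^{M−1}} ∏_{n=1}^{M} N(x_n; x_{n−1} + f(x_{n−1}, t_{n−1})·Δt_n, σ_n²·Δt_n) dx₁ ⋯ dx_{M−1} = N(b; a, V) · ∫_{ℝ^{M−1}} exp(S(x)) dβ(x), where S(x) = Σ_{n=1}^{M} [ σ_n⁻²·f(x_{n−1}, t_{n−1})·(x_n − x_{n−1}) − (1/2)·σ_n⁻²·f(x_{n−1}, t_{n−1})²·Δt_n ]. -/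

import Mathlib

open Real Finset MeasureTheory

/-- One-dimensional Gaussian density with mean `μ` and variance `v`. -/
noncomputable def gaussD (y μ v : ℝ) : ℝ :=
  (2 * π * v) ^ (-(1:ℝ)/2) * Real.exp (-(y - μ)^2 / (2 * v))

/-- The discrete path through the points `a, y₁, …, y_{M-1}, b`. -/
noncomputable def path (M : ℕ) (a b : ℝ) (y : Fin (M - 1) → ℝ) (n : ℕ) : ℝ :=
  if n = 0 then a else if h : n - 1 < M - 1 then y ⟨n - 1, h⟩ else b

theorem gaussD_pos (y μ : ℝ) {v : ℝ} (hv : 0 < v) : 0 < gaussD y μ v := by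
  unfold gaussD
  positivity

/-- Shifting the mean of a Gaussian density by a drift: the one-step Girsanov factor. -/
theorem gaussD_add_drift (y x c : ℝ) {s d : ℝ} (hs : 0 < s) (hd : 0 < d) :
    gaussD y (x + c * d) (s ^ 2 * d) =
      gaussD y x (s ^ 2 * d) *
        Real.exp ((s ^ 2)⁻¹ * c * (y - x) - (1 / 2) * (s ^ 2)⁻¹ * c ^ 2 * d) := by
  unfold gaussD
  rw [mul_assoc (_ ^ _), ← Real.exp_add]
  congr 2
  field_simp
  ring

theorem measurable_gaussD (v : ℝ) : Measurable fun p : ℝ × ℝ => gaussD p.1 p.2 v := by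
  unfold gaussD
  fun_prop

theorem measurable_path (M : ℕ) (a b : ℝ) (n : ℕ) : Measurable fun y => path M a b y n := by
  unfold path
  split_ifs <;> fun_prop

/-- Discrete-time analogue of Theorem 1 of the paper: the marginal transition
density of the Euler–Maruyama chain with drift `f` equals the drift-free
endpoint density times the expectation of `exp S` under the discrete Brownian
bridge measure `β` pinned at the endpoints. -/
theorem discrete_path_integral_importance_sampling
    (M : ℕ) (hM : 2 ≤ M) (t : ℕ → ℝ) (ht : ∀ n < M, t n < t (n + 1))
    (σ : ℕ → ℝ) (hσ : ∀ n, 1 ≤ n → n ≤ M → 0 < σ n)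
    (f : ℝ × ℝ → ℝ) (hf : Measurable f) (a b : ℝ)
    (V : ℝ) (hV : V = ∑ n ∈ Finset.range M, (σ (n+1))^2 * (t (n+1) - t n))
    (β : Measure (Fin (M - 1) → ℝ))
    (hβ : β = volume.withDensity (fun y => ENNReal.ofReal
      ((∏ n ∈ Finset.range M,
          gaussD (path M a b y (n+1)) (path M a b y n) ((σ (n+1))^2 * (t (n+1) - t n)))
        / gaussD b a V)))
    (S : (Fin (M - 1) → ℝ) → ℝ)
    (hS : S = fun y => ∑ n ∈ Finset.range M,
      (((σ (n+1))^2)⁻¹ * f (path M a b y n, t n) * (path M a b y (n+1) - path M a b y n)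
        - (1/2) * ((σ (n+1))^2)⁻¹ * (f (path M a b y n, t n))^2 * (t (n+1) - t n))) :
    (∫ y : Fin (M - 1) → ℝ,
        ∏ n ∈ Finset.range M,
          gaussD (path M a b y (n+1))
            (path M a b y n + f (path M a b y n, t n) * (t (n+1) - t n))
            ((σ (n+1))^2 * (t (n+1) - t n)))
      = gaussD b a V * ∫ y, Real.exp (S y) ∂β := by
  have hd : ∀ n ∈ Finset.range M, 0 < t (n + 1) - t n := fun n hn =>
    sub_pos.2 (ht n (Finset.mem_range.1 hn))
  have hs : ∀ n ∈ Finset.range M, 0 < σ (n + 1) := fun n hn =>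
    hσ (n + 1) (by omega) (Finset.mem_range.1 hn)
  have hv : ∀ n ∈ Finset.range M, 0 < (σ (n + 1)) ^ 2 * (t (n + 1) - t n) := fun n hn =>
    mul_pos (pow_pos (hs n hn) 2) (hd n hn)
  have hV_pos : 0 < V :=
    hV ▸ Finset.sum_pos hv (Finset.nonempty_range_iff.2 (by omega))
  have hb : 0 < gaussD b a V := gaussD_pos b a hV_pos
  have hmeas : Measurable fun y : Fin (M - 1) → ℝ => ENNReal.ofReal
      ((∏ n ∈ Finset.range M,
          gaussD (path M a b y (n+1)) (path M a b y n) ((σ (n+1))^2 * (t (n+1) - t n)))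
        / gaussD b a V) :=
    ((Finset.measurable_fun_prod _ fun n _ => (measurable_gaussD _).comp
      ((measurable_path M a b (n + 1)).prodMk (measurable_path M a b n))).div_const _).ennreal_ofReal
  rw [hβ, integral_withDensity_eq_integral_toReal_smul hmeas
    (Filter.Eventually.of_forall fun _ => ENNReal.ofReal_lt_top), ← integral_const_mul]
  refine integral_congr_ae (Filter.Eventually.of_forall fun y => ?_)
  have hprod : 0 ≤ ∏ n ∈ Finset.range M,
      gaussD (path M a b y (n+1)) (path M a b y n) ((σ (n+1))^2 * (t (n+1) - t n)) :=
    Finset.prod_nonneg fun n hn => (gaussD_pos _ _ (hv n hn)).le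
  simp only [hS, smul_eq_mul]
  rw [ENNReal.toReal_ofReal (div_nonneg hprod hb.le), ← mul_assoc, mul_div_cancel₀ _ hb.ne',
    Real.exp_sum, ← Finset.prod_mul_distrib]
  exact Finset.prod_congr rfl fun n hn => gaussD_add_drift _ _ _ (hs n hn) (hd n hn)
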